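/- For every even integer n ≥ 6, the path P_n on n vertices has edge-reconstruction number ern(P_n) = 2. -/

import Mathlib

open SimpleGraph

namespace ErnPaper

/-- The weight of a vertex `v` in a graph `G`: the number of vertices in a largest
connected component of `G - v`. -/
noncomputable def wt {V : Type} [Fintype V] (G : SimpleGraph V) (v : V) : ℕ :=
  sSup {n | ∃ c : (G.induce ({v}ᶜ : Set V)).ConnectedComponent, n = Nat.card c.supp}

/-- The centroid of a graph: the set of vertices of minimum weight. -/
def centroid {V : Type} [Fintype V] (G : SimpleGraph V) : Set V :=
  {v | ∀ u, wt G v ≤ wt G u}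

/-- The edge-reconstruction number of a finite graph `G`: the least `k` for which there exist
`k` distinct edges `e₁, …, e_k` of `G` such that any finite graph `H` having `k` distinct
edges `f₁, …, f_k` with `H - fᵢ ≅ G - eᵢ` for all `i` must be isomorphic to `G`. -/
noncomputable def ern {V : Type} [Fintype V] (G : SimpleGraph V) : ℕ :=
  sInf {k | ∃ s : Finset (Sym2 V), s.card = k ∧ (↑s : Set (Sym2 V)) ⊆ G.edgeSet ∧
    ∀ (W : Type) (_ : Fintype W) (H : SimpleGraph W) (t : Finset (Sym2 W)),
      (↑t : Set (Sym2 W)) ⊆ H.edgeSet →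
      (∃ φ : {e // e ∈ s} ≃ {f // f ∈ t},
        ∀ e : {e // e ∈ s},
          Nonempty (H.deleteEdges {(φ e).1} ≃g G.deleteEdges {e.1})) →
      Nonempty (H ≃g G)}

/-- The spider tree `S_{p,q,r}`: three paths with `p`, `q`, `r` edges respectively,
emanating from a common central vertex. -/
def spider (p q r : ℕ) : SimpleGraph (Unit ⊕ (Fin p ⊕ Fin q ⊕ Fin r)) :=
  SimpleGraph.fromRel fun x y =>
    match x, y with
    | Sum.inl _, Sum.inr (Sum.inl j) => (j : ℕ) = 0
    | Sum.inl _, Sum.inr (Sum.inr (Sum.inl j)) => (j : ℕ) = 0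
    | Sum.inl _, Sum.inr (Sum.inr (Sum.inr j)) => (j : ℕ) = 0
    | Sum.inr (Sum.inl i), Sum.inr (Sum.inl j) => (j : ℕ) = (i : ℕ) + 1
    | Sum.inr (Sum.inr (Sum.inl i)), Sum.inr (Sum.inr (Sum.inl j)) => (j : ℕ) = (i : ℕ) + 1
    | Sum.inr (Sum.inr (Sum.inr i)), Sum.inr (Sum.inr (Sum.inr j)) => (j : ℕ) = (i : ℕ) + 1
    | _, _ => False

/-- A pseudopath: a tree isomorphic to a path `P_k`, to `S_{1,1,2}`, or to `S_{1,2,3}`. -/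
def IsPseudopath {V : Type} (T : SimpleGraph V) : Prop :=
  (∃ k, Nonempty (T ≃g pathGraph k)) ∨
    Nonempty (T ≃g spider 1 1 2) ∨ Nonempty (T ≃g spider 1 2 3)

/-- `T - xv + yv`: delete the end-edge `xv` and add the new edge `yv`. -/
def replaceEdge {V : Type} (T : SimpleGraph V) (x v y : V) : SimpleGraph V :=
  SimpleGraph.fromEdgeSet ((T.edgeSet \ {s(x, v)}) ∪ {s(y, v)})

/-- The disjoint union of two simple graphs. -/
def disjUnion {α β : Type} (G : SimpleGraph α) (H : SimpleGraph β) :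
    SimpleGraph (α ⊕ β) :=
  SimpleGraph.fromRel fun x y =>
    match x, y with
    | Sum.inl a, Sum.inl b => G.Adj a b
    | Sum.inr a, Sum.inr b => H.Adj a b
    | _, _ => False

/-- The caterpillar `C(2,0,…,0,2)` with spine on `m` vertices: spine path `v₀ … v_{m-1}`,
with two extra endvertices adjacent to `v₀` and two to `v_{m-1}`. -/
def doubleBroom (m : ℕ) : SimpleGraph (Fin m ⊕ Fin 4) :=
  SimpleGraph.fromRel fun x y =>
    match x, y with
    | Sum.inl i, Sum.inl j => (j : ℕ) = (i : ℕ) + 1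
    | Sum.inl i, Sum.inr l =>
        ((i : ℕ) = 0 ∧ (l : ℕ) < 2) ∨ ((i : ℕ) = m - 1 ∧ 2 ≤ (l : ℕ))
    | _, _ => False


/-- Cardinality of a set of naturals that is constant on three consecutive intervals. -/
lemma card_three (A : ℕ → Prop) [DecidablePred A] (i j k : ℕ) (h1 : i < j) (h2 : j < k)
    (c1 : ∀ a, a < i → (A a ↔ A 0)) (c2 : ∀ a, i ≤ a → a < j → (A a ↔ A i))
    (c3 : ∀ a, j ≤ a → a < k → (A a ↔ A j)) :
    ((Finset.range k).filter A).card =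
      (if A 0 then i else 0) + (if A i then j - i else 0) + (if A j then k - j else 0) := by
  have e : ∀ (l r : ℕ), (∀ a, l ≤ a → a < r → (A a ↔ A l)) →
      ((Finset.Ico l r).filter A).card = if A l then r - l else 0 := by
    intro l r h
    split_ifs with hl
    · rw [Finset.filter_true_of_mem]
      · simp
      · intro a ha
        rw [Finset.mem_Ico] at ha
        exact (h a ha.1 ha.2).2 hl
    · rw [Finset.filter_false_of_mem]
      · simp
      · intro a ha
        rw [Finset.mem_Ico] at ha
        exact fun hh => hl ((h a ha.1 ha.2).1 hh)
  have e1 := e 0 i (fun a _ h => c1 a h)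
  have e2 := e i j c2
  have e3 := e j k c3
  rw [Nat.sub_zero] at e1
  rw [← e1, ← e2, ← e3, Finset.range_eq_Ico, ← Finset.Ico_union_Ico_eq_Ico (Nat.zero_le j) h2.le,
    Finset.filter_union, Finset.card_union_of_disjoint,
    ← Finset.Ico_union_Ico_eq_Ico (Nat.zero_le i) h1.le,
    Finset.filter_union, Finset.card_union_of_disjoint]
  · exact Finset.disjoint_filter_filter (Finset.Ico_disjoint_Ico_consecutive _ _ _)
  · exact Finset.disjoint_filter_filter (Finset.Ico_disjoint_Ico_consecutive _ _ _)

lemma const_of_step (A : ℕ → Prop) (l r : ℕ) (h : ∀ a, l ≤ a → a + 1 < r → (A a ↔ A (a+1))) :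
    ∀ a, l ≤ a → a < r → (A a ↔ A l) := by
  intro a hl
  induction a, hl using Nat.le_induction with
  | base => intro _; rfl
  | succ a ha ih => intro hr; rw [← h a ha hr]; exact ih (by omega)

lemma card_sigma {n k : ℕ} (hk : k ≤ n) (σ : Fin n ≃ Fin n) [DecidablePred fun a : ℕ => ∃ h : a < n, (σ ⟨a, h⟩).1 < k]:
    ((Finset.range n).filter (fun a => ∃ h : a < n, (σ ⟨a, h⟩).1 < k)).card = k := by
  conv_rhs => rw [← Finset.card_range k]
  refine Finset.card_bij (fun a _ => if h : a < n then (σ ⟨a, h⟩).1 else 0) ?_ ?_ ?_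
  · intro a ha
    simp only [Finset.mem_filter, Finset.mem_range] at ha ⊢
    obtain ⟨h, h'⟩ := ha.2
    simpa [h] using h'
  · intro a ha b hb hab
    simp only [Finset.mem_filter, Finset.mem_range] at ha hb
    simp only [ha.1, hb.1, dif_pos] at hab
    have := σ.injective (Fin.ext hab)
    simpa using this
  · intro b hb
    rw [Finset.mem_range] at hb
    refine ⟨(σ.symm ⟨b, by omega⟩).1, ?_, ?_⟩
    · simp [hb]
    · simp

lemma core (m : ℕ) (hm : 3 ≤ m) (H : SimpleGraph (Fin (2*m))) (u v p q : Fin (2*m))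
    (hpq : H.Adj p q) (hne : s(u,v) ≠ s(p,q))
    (h1 : ∀ a b : Fin (2*m), (H.Adj a b ∧ s(a,b) ≠ s(u,v)) ↔
      ((a.1+1 = b.1 ∨ b.1+1 = a.1) ∧ a.1+b.1 ≠ 2*m-1))
    (σ : Fin (2*m) ≃ Fin (2*m))
    (h2 : ∀ a b : Fin (2*m), (H.Adj a b ∧ s(a,b) ≠ s(p,q)) ↔
      (((σ a).1+1 = (σ b).1 ∨ (σ b).1+1 = (σ a).1) ∧ (σ a).1+(σ b).1 ≠ 2*m-3)) :
    ∃ x y : Fin (2*m), s(u,v) = s(x,y) ∧ (x.1 = 0 ∨ x.1 = m-1) ∧ (y.1 = m ∨ y.1 = 2*m-1) := by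
  classical
  wlog hw : p.1 + 1 = q.1 generalizing p q with H0
  · have := (h1 p q).1 ⟨hpq, hne.symm⟩
    refine H0 q p hpq.symm ?_ ?_ (by omega)
    · rwa [Sym2.eq_swap (a := q)]
    · intro a b; rw [Sym2.eq_swap (a := q)]; exact h2 a b
  have hpq1 := (h1 p q).1 ⟨hpq, hne.symm⟩
  have hpq2 := hpq1.2
  have hq := q.2
  -- crossing
  have cross : ∀ a b, H.Adj a b → s(a,b) ≠ s(p,q) → ((σ a).1 < m-1 ↔ (σ b).1 < m-1) := by
    intro a b h h'
    have := (h2 a b).1 ⟨h, h'⟩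
    omega
  have fin : ∀ x y : Fin (2*m), s(x,y) = s(p,q) → ¬ (σ x).1 < m-1 → (σ y).1 < m-1 →
      (∀ b : Fin (2*m), ((x.1+1 = b.1 ∨ b.1+1 = x.1) ∧ x.1+b.1 ≠ 2*m-1) → s(x,b) = s(p,q)) →
      ∃ z, s(u,v) = s(x,z) ∧ z ≠ x ∧ ¬ (σ z).1 < m-1 ∧
        (z.1 = 0 ∨ z.1 = m-1 ∨ z.1 = m ∨ z.1 = 2*m-1) := by
    intro x y hxy hx hy hb
    have ⟨w, hw⟩ : ∃ w : Fin (2*m), (((σ x).1+1 = w.1 ∨ w.1+1 = (σ x).1) ∧ (σ x).1+w.1 ≠ 2*m-3) := by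
      have := (σ x).2
      by_cases h : (σ x).1 = m-1
      · exact ⟨⟨m, by omega⟩, by simp only; omega⟩
      · exact ⟨⟨(σ x).1 - 1, by omega⟩, by simp only; omega⟩
    obtain ⟨z, rfl⟩ := σ.surjective w
    obtain ⟨hxz, hxz'⟩ := (h2 x z).2 hw
    have hz : s(u,v) = s(x,z) := by
      by_contra hc
      exact hxz' (hb z ((h1 x z).1 ⟨hxz, Ne.symm hc⟩))
    have hAz : ¬ (σ z).1 < m-1 := by rwa [← cross x z hxz hxz']
    have hzx : z ≠ x := hxz.ne'
    have hzy : z ≠ y := by rintro rfl; exact hAz hy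
    refine ⟨z, hz, hzx, hAz, ?_⟩
    by_contra hc
    have hz2 := z.2
    have key : ∀ b : Fin (2*m), ((z.1+1 = b.1 ∨ b.1+1 = z.1) ∧ z.1+b.1 ≠ 2*m-1) →
        b ≠ x ∧ (((σ z).1+1 = (σ b).1 ∨ (σ b).1+1 = (σ z).1)) := by
      intro b hb'
      obtain ⟨k1, k2⟩ := (h1 z b).2 hb'
      refine ⟨?_, ((h2 z b).1 ⟨k1, ?_⟩).1⟩
      · rintro rfl
        exact k2 (by rw [hz, Sym2.eq_swap])
      · rw [← hxy]
        intro hh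
        have : z ∈ s(x,y) := by rw [← hh]; simp
        simp [hzx, hzy] at this
    obtain ⟨zp, hzp⟩ : ∃ w : Fin (2*m), w.1 = z.1+1 := ⟨⟨z.1+1, by omega⟩, rfl⟩
    obtain ⟨zm, hzm⟩ : ∃ w : Fin (2*m), w.1 = z.1-1 := ⟨⟨z.1-1, by omega⟩, rfl⟩
    obtain ⟨a1, a2⟩ := key zp (by omega)
    obtain ⟨b1, b2⟩ := key zm (by omega)
    have i1 : (σ zp).1 ≠ (σ x).1 := fun h => a1 (σ.injective (Fin.ext h))
    have i2 : (σ zm).1 ≠ (σ x).1 := fun h => b1 (σ.injective (Fin.ext h))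
    have i3 : (σ zp).1 ≠ (σ zm).1 := by
      intro h
      have := congrArg Fin.val (σ.injective (Fin.ext h))
      omega
    have i4 := hw.1
    omega
  -- counting
  obtain ⟨A, hA, hcard⟩ : ∃ A : ℕ → Prop, (∀ a, A a ↔ ∃ h : a < 2*m, (σ ⟨a, h⟩).1 < m-1) ∧
      ((Finset.range (2*m)).filter A).card = m-1 :=
    ⟨fun a => ∃ h : a < 2*m, (σ ⟨a, h⟩).1 < m-1, fun a => Iff.rfl,
      by convert card_sigma (k := m-1) (by omega) σ⟩
  have step : ∀ a, a+1 < 2*m → a ≠ p.1 → a ≠ m-1 → (A a ↔ A (a+1)) := by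
    intro a ha hp hm'
    obtain ⟨k1, k2⟩ := (h1 ⟨a, by omega⟩ ⟨a+1, ha⟩).2 ⟨Or.inl rfl, by show a+(a+1) ≠ 2*m-1; omega⟩
    have := cross _ _ k1 (by
      intro hh
      simp only [Sym2.eq_iff, Fin.ext_iff] at hh
      omega)
    rw [hA, hA]
    constructor
    · rintro ⟨h, h'⟩
      exact ⟨ha, this.1 h'⟩
    · rintro ⟨h, h'⟩
      exact ⟨by omega, this.2 h'⟩
  have AA : ∀ a : Fin (2*m), A a.1 ↔ (σ a).1 < m-1 := fun a => by
    rw [hA]; exact ⟨fun ⟨_, h⟩ => h, fun h => ⟨a.2, h⟩⟩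
  have symq : s(q,p) = s(p,q) := Sym2.eq_swap
  rcases lt_or_ge p.1 m with hpm | hpm
  · have c1 := const_of_step A 0 (p.1+1) (fun a _ h => step a (by omega) (by omega) (by omega))
    have c2 := const_of_step A (p.1+1) m (fun a _ h => step a (by omega) (by omega) (by omega))
    have c3 := const_of_step A m (2*m) (fun a _ h => step a (by omega) (by omega) (by omega))
    have hc := card_three A (p.1+1) m (2*m) (by omega) (by omega)
      (fun a h => c1 a (by omega) h) c2 c3
    rw [hcard] at hc
    have ap := c1 p.1 (by omega) (by omega)
    have aq : A q.1 ↔ A (p.1+1) := by rw [hw]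
    rw [AA] at ap aq
    by_cases hA3 : A m
    · simp only [hA3, if_true] at hc; omega
    by_cases hA1 : A 0 <;> by_cases hA2 : A (p.1+1) <;>
      simp only [hA1, hA2, hA3, if_true, if_false] at hc
    · omega
    · obtain ⟨z, z1, z0, z2, z3⟩ := fin q p symq (by tauto) (by tauto) (by
        intro b hb
        have : b = p := Fin.ext (by omega)
        rw [this, symq])
      refine ⟨q, z, z1, by omega, ?_⟩
      have r0 : z.1 ≠ 0 := fun r => by rw [← AA, r] at z2; exact z2 hA1
      have r1 : z.1 ≠ q.1 := fun r => z0 (Fin.ext r)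
      omega
    · obtain ⟨z, z1, z0, z2, z3⟩ := fin p q rfl (by tauto) (by tauto) (by
        intro b hb
        have : b = q := Fin.ext (by omega)
        rw [this])
      refine ⟨p, z, z1, by omega, ?_⟩
      have r0 : z.1 ≠ m-1 := fun r => by
        rw [← AA, r] at z2; exact z2 ((c2 (m-1) (by omega) (by omega)).2 hA2)
      have r1 : z.1 ≠ p.1 := fun r => z0 (Fin.ext r)
      omega
    · omega
  · have c1 := const_of_step A 0 m (fun a _ h => step a (by omega) (by omega) (by omega))
    have c2 := const_of_step A m (p.1+1) (fun a _ h => step a (by omega) (by omega) (by omega))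
    have c3 := const_of_step A (p.1+1) (2*m)
      (fun a _ h => step a (by omega) (by omega) (by omega))
    have hc := card_three A m (p.1+1) (2*m) (by omega) (by omega)
      (fun a h => c1 a (by omega) h) c2 c3
    rw [hcard] at hc
    have ap := c2 p.1 (by omega) (by omega)
    have aq : A q.1 ↔ A (p.1+1) := by rw [hw]
    rw [AA] at ap aq
    by_cases hA3 : A 0
    · simp only [hA3, if_true] at hc; omega
    by_cases hA1 : A m <;> by_cases hA2 : A (p.1+1) <;>
      simp only [hA1, hA2, hA3, if_true, if_false] at hc
    · omega
    · obtain ⟨z, z1, z0, z2, z3⟩ := fin q p symq (by tauto) (by tauto) (by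
        intro b hb
        have : b = p := Fin.ext (by omega)
        rw [this, symq])
      refine ⟨z, q, by rw [z1, Sym2.eq_swap], ?_, by omega⟩
      have r0 : z.1 ≠ m := fun r => by rw [← AA, r] at z2; exact z2 hA1
      have r1 : z.1 ≠ q.1 := fun r => z0 (Fin.ext r)
      omega
    · obtain ⟨z, z1, z0, z2, z3⟩ := fin p q rfl (by tauto) (by tauto) (by
        intro b hb
        have : b = q := Fin.ext (by omega)
        rw [this])
      refine ⟨z, p, by rw [z1, Sym2.eq_swap], ?_, by omega⟩
      have r0 : z.1 ≠ 2*m-1 := fun r => by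
        rw [← AA, r] at z2; exact z2 ((c3 (2*m-1) (by omega) (by omega)).2 hA2)
      have r1 : z.1 ≠ p.1 := fun r => z0 (Fin.ext r)
      omega
    · omega

/-- Rearranging two halves of the vertex set. -/
def flip (m : ℕ) (b c : Bool) (a : ℕ) : ℕ :=
  if a < m then (if b then a else m - 1 - a) else (if c then a else 3*m - 1 - a)

lemma flip_lt {m a : ℕ} (b c : Bool) (h : a < 2*m) : flip m b c a < 2*m := by
  unfold flip; split_ifs <;> omega

lemma flip_flip {m a : ℕ} (b c : Bool) (h : a < 2*m) : flip m b c (flip m b c a) = a := by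
  unfold flip; split_ifs <;> omega

lemma core_iso (m : ℕ) (hm : 3 ≤ m) (H : SimpleGraph (Fin (2*m))) (x y : Fin (2*m))
    (huv : H.Adj x y)
    (h1 : ∀ a b : Fin (2*m), (H.Adj a b ∧ s(a,b) ≠ s(x,y)) ↔
      ((a.1+1 = b.1 ∨ b.1+1 = a.1) ∧ a.1+b.1 ≠ 2*m-1))
    (hx : x.1 = 0 ∨ x.1 = m-1) (hy : y.1 = m ∨ y.1 = 2*m-1) :
    Nonempty (H ≃g pathGraph (2*m)) := by
  obtain ⟨b, hb⟩ : ∃ b : Bool, x.1 = if b then m-1 else 0 := by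
    rcases hx with h | h
    · exact ⟨false, by simpa using h⟩
    · exact ⟨true, by simpa using h⟩
  obtain ⟨c, hc⟩ : ∃ c : Bool, y.1 = if c then m else 2*m-1 := by
    rcases hy with h | h
    · exact ⟨true, by simpa using h⟩
    · exact ⟨false, by simpa using h⟩
  let f : Fin (2*m) → Fin (2*m) := fun a => ⟨flip m b c a.1, flip_lt b c a.2⟩
  have hf : Function.Involutive f := fun a => Fin.ext (flip_flip b c a.2)
  refine ⟨⟨hf.toPerm f, ?_⟩⟩
  intro u v
  have e : H.Adj u v ↔ (((u.1+1 = v.1 ∨ v.1+1 = u.1) ∧ u.1+v.1 ≠ 2*m-1) ∨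
      ((u.1 = x.1 ∧ v.1 = y.1) ∨ (u.1 = y.1 ∧ v.1 = x.1))) := by
    have e2 : s(u,v) = s(x,y) ↔ ((u.1 = x.1 ∧ v.1 = y.1) ∨ (u.1 = y.1 ∧ v.1 = x.1)) := by
      simp only [Sym2.eq_iff, Fin.ext_iff]
    rw [← h1, ← e2]
    by_cases h : s(u,v) = s(x,y)
    · have : H.Adj u v := by
        rw [← SimpleGraph.mem_edgeSet, h]; exact huv
      tauto
    · tauto
  rw [e, pathGraph_adj]
  have hu := u.2
  have hv := v.2
  change flip m b c u.1 + 1 = flip m b c v.1 ∨ flip m b c v.1 + 1 = flip m b c u.1 ↔ _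
  rw [hb, hc]
  unfold flip
  cases b <;> cases c <;> simp only [if_true, if_false, Bool.false_eq_true] <;> split_ifs <;> omega

lemma upper (m : ℕ) (hm : 3 ≤ m) (W : Type) (H : SimpleGraph W) (f1 f2 : Sym2 W)
    (e1 e2 : Sym2 (Fin (2*m))) (he1 : e1 = s(⟨m-1, by omega⟩, ⟨m, by omega⟩))
    (he2 : e2 = s(⟨m-2, by omega⟩, ⟨m-1, by omega⟩))
    (hf1 : f1 ∈ H.edgeSet) (hf2 : f2 ∈ H.edgeSet) (hne : f1 ≠ f2)
    (ψ1 : H.deleteEdges {f1} ≃g (pathGraph (2*m)).deleteEdges {e1})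
    (ψ2 : H.deleteEdges {f2} ≃g (pathGraph (2*m)).deleteEdges {e2}) :
    Nonempty (H ≃g pathGraph (2*m)) := by
  let g : Fin (2*m) ≃ W := ψ1.symm.toEquiv
  let K : SimpleGraph (Fin (2*m)) := H.comap g
  have iso : K ≃g H := ⟨g, Iff.rfl⟩
  have rep : ∀ f : Sym2 W, ∃ u v, f = s(g u, g v) := by
    intro f
    induction f using Sym2.ind with
    | _ a b => exact ⟨g.symm a, g.symm b, by simp⟩
  obtain ⟨u, v, huv⟩ := rep f1
  obtain ⟨p, q, hpq⟩ := rep f2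
  have gs : ∀ a b c d : Fin (2*m), s(g a, g b) = s(g c, g d) ↔ s(a,b) = s(c,d) := by
    intro a b c d
    simp only [Sym2.eq_iff, g.injective.eq_iff]
  have hpath1 : ∀ a b : Fin (2*m), ((pathGraph (2*m)).deleteEdges {e1}).Adj a b ↔
      ((a.1+1 = b.1 ∨ b.1+1 = a.1) ∧ a.1+b.1 ≠ 2*m-1) := by
    intro a b
    rw [deleteEdges_adj, pathGraph_adj, he1, Set.mem_singleton_iff, Sym2.eq_iff]
    simp only [Fin.ext_iff]
    omega
  have hpath2 : ∀ a b : Fin (2*m), ((pathGraph (2*m)).deleteEdges {e2}).Adj a b ↔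
      ((a.1+1 = b.1 ∨ b.1+1 = a.1) ∧ a.1+b.1 ≠ 2*m-3) := by
    intro a b
    rw [deleteEdges_adj, pathGraph_adj, he2, Set.mem_singleton_iff, Sym2.eq_iff]
    simp only [Fin.ext_iff]
    omega
  have h1 : ∀ a b : Fin (2*m), (K.Adj a b ∧ s(a,b) ≠ s(u,v)) ↔
      ((a.1+1 = b.1 ∨ b.1+1 = a.1) ∧ a.1+b.1 ≠ 2*m-1) := by
    intro a b
    rw [← hpath1, ← ψ1.symm.map_adj_iff, deleteEdges_adj, Set.mem_singleton_iff]
    change _ ↔ H.Adj (g a) (g b) ∧ ¬ s(g a, g b) = _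
    rw [huv, gs]; rfl
  let σ : Fin (2*m) ≃ Fin (2*m) := g.trans ψ2.toEquiv
  have h2 : ∀ a b : Fin (2*m), (K.Adj a b ∧ s(a,b) ≠ s(p,q)) ↔
      (((σ a).1+1 = (σ b).1 ∨ (σ b).1+1 = (σ a).1) ∧ (σ a).1+(σ b).1 ≠ 2*m-3) := by
    intro a b
    rw [← hpath2]
    change _ ↔ ((pathGraph (2*m)).deleteEdges {e2}).Adj (ψ2 (g a)) (ψ2 (g b))
    rw [ψ2.map_adj_iff, deleteEdges_adj, Set.mem_singleton_iff, hpq, gs]; rfl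
  obtain ⟨x, y, hxy, hx, hy⟩ := core m hm K u v p q (by rw [hpq] at hf2; exact hf2)
    (by rwa [huv, hpq, Ne, gs] at hne) h1 σ h2
  rw [hxy] at h1
  have hK : K.Adj x y := by
    rw [← SimpleGraph.mem_edgeSet, ← hxy]; rw [huv] at hf1; exact hf1
  obtain ⟨τ⟩ := core_iso m hm K x y hK h1 hx hy
  exact ⟨iso.symm.trans τ⟩

lemma lower (n : ℕ) (hn : 6 ≤ n) (e : Sym2 (Fin n)) (he : e ∈ (pathGraph n).edgeSet) :
    ∃ (H : SimpleGraph (Fin n)) (f : Sym2 (Fin n)), f ∈ H.edgeSet ∧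
      Nonempty (H.deleteEdges {f} ≃g (pathGraph n).deleteEdges {e}) ∧
      ¬ Nonempty (H ≃g pathGraph n) := by
  obtain ⟨i, hi, h1, h2⟩ : ∃ i, ∃ hi : i + 2 < n,
      e ≠ s(⟨i, by omega⟩, ⟨i+1, by omega⟩) ∧ e ≠ s(⟨i+1, by omega⟩, ⟨i+2, by omega⟩) := by
    by_cases h : e = s(⟨0, by omega⟩, ⟨1, by omega⟩) ∨ e = s(⟨1, by omega⟩, ⟨2, by omega⟩)
    · refine ⟨3, by omega, ?_⟩
      rcases h with rfl | rfl <;> simp [Fin.ext_iff]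
    · push Not at h
      exact ⟨0, by omega, h⟩
  set a : Fin n := ⟨i, by omega⟩
  set b : Fin n := ⟨i+1, by omega⟩
  set c : Fin n := ⟨i+2, by omega⟩
  have hac : a ≠ c := by simp [a, c, Fin.ext_iff]
  have nac : ¬ (pathGraph n).Adj a c := by
    rw [pathGraph_adj]; simp only [a, c]; omega
  have hab : (pathGraph n).Adj a b := by
    rw [pathGraph_adj]; exact Or.inl rfl
  have hbc : (pathGraph n).Adj b c := by
    rw [pathGraph_adj]; exact Or.inl rfl
  let H : SimpleGraph (Fin n) := (pathGraph n).deleteEdges {e} ⊔ edge a c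
  have Hac : H.Adj a c := Or.inr (by simp [edge_adj, hac])
  have Hab : H.Adj a b := Or.inl (by
    rw [deleteEdges_adj]; exact ⟨hab, fun h => h1 h.symm⟩)
  have Hbc : H.Adj b c := Or.inl (by
    rw [deleteEdges_adj]; exact ⟨hbc, fun h => h2 h.symm⟩)
  refine ⟨H, s(a,c), Hac, ⟨?_⟩, ?_⟩
  · have : H.deleteEdges {s(a,c)} = (pathGraph n).deleteEdges {e} := by
      ext x y
      simp only [H, deleteEdges_adj, sup_adj, edge_adj, Set.mem_singleton_iff]
      constructor
      · rintro ⟨h | h, h'⟩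
        · exact h
        · exact absurd (by rw [Sym2.eq_iff]; tauto) h'
      · rintro ⟨h, h'⟩
        refine ⟨Or.inl ⟨h, h'⟩, ?_⟩
        intro hh
        rw [← SimpleGraph.mem_edgeSet, hh] at h
        exact nac h
    rw [this]
  · rintro ⟨τ⟩
    have t1 := τ.map_adj_iff.2 Hac
    have t2 := τ.map_adj_iff.2 Hab
    have t3 := τ.map_adj_iff.2 Hbc
    rw [pathGraph_adj] at t1 t2 t3
    omega

/-- For every even `n ≥ 6`, the path `P_n` has edge-reconstruction number 2. -/
theorem stmt8 (n : ℕ) (hn : 6 ≤ n) (he : Even n) : ern (pathGraph n) = 2 := by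
  obtain ⟨m, hm⟩ := he
  obtain rfl : n = 2*m := by omega
  have hm3 : 3 ≤ m := by omega
  unfold ern
  refine IsLeast.csInf_eq ⟨?_, ?_⟩
  · let e1 : Sym2 (Fin (2*m)) := s(⟨m-1, by omega⟩, ⟨m, by omega⟩)
    let e2 : Sym2 (Fin (2*m)) := s(⟨m-2, by omega⟩, ⟨m-1, by omega⟩)
    have hne : e1 ≠ e2 := by
      simp only [e1, e2, Ne, Sym2.eq_iff, Fin.ext_iff]; omega
    refine ⟨{e1, e2}, Finset.card_pair hne, ?_, ?_⟩
    · intro e h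
      simp only [Finset.coe_insert, Finset.coe_singleton, Set.mem_insert_iff,
        Set.mem_singleton_iff] at h
      rcases h with rfl | rfl
      · rw [SimpleGraph.mem_edgeSet, pathGraph_adj]; simp only; omega
      · rw [SimpleGraph.mem_edgeSet, pathGraph_adj]; simp only; omega
    · rintro W _ H t ht ⟨φ, hφ⟩
      obtain ⟨ψ1⟩ := hφ ⟨e1, by simp⟩
      obtain ⟨ψ2⟩ := hφ ⟨e2, by simp⟩
      refine upper m hm3 W H _ _ e1 e2 rfl rfl (ht (φ _).2) (ht (φ _).2) ?_ ψ1 ψ2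
      intro h
      have := φ.injective (Subtype.ext h)
      exact hne (congrArg Subtype.val this)
  · rintro k ⟨s, hs, hsub, hs2⟩
    by_contra hk
    have : k = 0 ∨ k = 1 := by omega
    rcases this with rfl | rfl
    · rw [Finset.card_eq_zero] at hs
      subst hs
      obtain ⟨τ⟩ := hs2 Empty inferInstance ⊥ ∅ (by simp)
        ⟨Equiv.equivOfIsEmpty _ _, fun e => absurd e.2 (Finset.notMem_empty _)⟩
      exact (τ.symm ⟨0, by omega⟩).elim
    · rw [Finset.card_eq_one] at hs
      obtain ⟨e, rfl⟩ := hs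
      obtain ⟨H, f, hf, hiso, hnot⟩ := lower (2*m) hn e (hsub (by simp))
      refine hnot (hs2 (Fin (2*m)) inferInstance H {f} (by simpa using hf)
        ⟨Equiv.ofUnique _ _, ?_⟩)
      rintro ⟨e', he'⟩
      obtain rfl := Finset.mem_singleton.1 he'
      exact hiso

end ErnPaper
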